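/- For every positive integer n, the set of (n+2)-feasible pairs (t,u) of nonnegative integers has cardinality at least ⌊(1+√2)^{n+1}/(2√2)⌋. -/

import Mathlib

/-- The number of spanning trees of a finite simple graph `G`: the number of
subgraphs `T ≤ G` (on the same vertex set) that are trees. -/
noncomputable def numSpanningTrees {V : Type} [Fintype V] (G : SimpleGraph V) : ℕ :=
  Set.ncard {T : SimpleGraph V | T ≤ G ∧ T.IsTree}

/-- A pair `(t, u)` of nonnegative integers is `n`-feasible if there is a simple graph `G`
on at most `n` vertices with an edge `e` such that `t` is the number of spanning trees of
`G` containing `e` and `u` is the number of spanning trees of `G` not containing `e`. -/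
def EdgeFeasible (n t u : ℕ) : Prop :=
  ∃ (m : ℕ) (G : SimpleGraph (Fin m)) (e : Sym2 (Fin m)),
    m ≤ n ∧ e ∈ G.edgeSet ∧
    t = Set.ncard {T : SimpleGraph (Fin m) | T ≤ G ∧ T.IsTree ∧ e ∈ T.edgeSet} ∧
    u = Set.ncard {T : SimpleGraph (Fin m) | T ≤ G ∧ T.IsTree ∧ e ∉ T.edgeSet}

open SimpleGraph in
/-- The pair counts of a graph on an arbitrary finite vertex type are feasible. -/
lemma edgeFeasible_of_card_le {V : Type} [Fintype V] {n : ℕ} (hV : Fintype.card V ≤ n)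
    (G : SimpleGraph V) {x y : V} (hxy : G.Adj x y) :
    EdgeFeasible n (Set.ncard {T : SimpleGraph V | T ≤ G ∧ T.IsTree ∧ T.Adj x y})
      (Set.ncard {T : SimpleGraph V | T ≤ G ∧ T.IsTree ∧ ¬T.Adj x y}) := by
  let φ := Fintype.equivFin V
  have key (P : Prop → Prop) :
      Set.ncard {T : SimpleGraph V | T ≤ G ∧ T.IsTree ∧ P (T.Adj x y)} =
      Set.ncard {T : SimpleGraph (Fin (Fintype.card V)) |
        T ≤ φ.simpleGraph G ∧ T.IsTree ∧ P (s(φ x, φ y) ∈ T.edgeSet)} := by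
    rw [← Set.ncard_image_of_injective _ φ.simpleGraph.injective, Equiv.image_eq_preimage_symm]
    congr 1
    ext T
    have hT : (φ.simpleGraph.symm T).IsTree ↔ T.IsTree := Iso.isTree_iff (Iso.comap φ T)
    have hle : φ.simpleGraph.symm T ≤ G ↔ T ≤ φ.simpleGraph G := by
      constructor
      · intro h a b hab
        exact h (show T.Adj (φ (φ.symm a)) (φ (φ.symm b)) by simpa using hab)
      · intro h a b hab
        simpa [Equiv.simpleGraph] using h (show T.Adj (φ a) (φ b) from hab)
    simp only [Set.mem_preimage, Set.mem_ofPred_eq, hT, hle]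
    rfl
  refine ⟨Fintype.card V, φ.simpleGraph G, s(φ x, φ y), hV, ?_, key id, key Not⟩
  simpa [Equiv.simpleGraph] using hxy

lemma finite_setOf_edgeFeasible (n : ℕ) : {p : ℕ × ℕ | EdgeFeasible n p.1 p.2}.Finite := by
  have h : {p : ℕ × ℕ | EdgeFeasible n p.1 p.2} ⊆ ⋃ m ∈ Set.Iic n,
      Set.range fun q : SimpleGraph (Fin m) × Sym2 (Fin m) ↦
        (Set.ncard {T : SimpleGraph (Fin m) | T ≤ q.1 ∧ T.IsTree ∧ q.2 ∈ T.edgeSet},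
          Set.ncard {T : SimpleGraph (Fin m) | T ≤ q.1 ∧ T.IsTree ∧ q.2 ∉ T.edgeSet}) := by
    rintro ⟨t, u⟩ ⟨m, G, e, hm, -, ht, hu⟩
    simp only [Set.mem_iUnion]
    exact ⟨m, hm, (G, e), Prod.ext ht.symm hu.symm⟩
  exact ((Set.finite_Iic n).biUnion fun m _ ↦ Set.finite_range _).subset h

namespace SimpleGraph

variable {V : Type}

/-- The graph obtained from `G` by adding a new vertex `none` adjacent to the vertices in `s`. -/
def addVertex (G : SimpleGraph V) (s : Set V) : SimpleGraph (Option V) where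
  Adj
    | none, none => False
    | none, some b => b ∈ s
    | some a, none => a ∈ s
    | some a, some b => G.Adj a b
  symm := ⟨by
    rintro (_ | a) (_ | b) h
    exacts [h, h, h, G.adj_symm h]⟩
  loopless := ⟨by
    rintro (_ | a) h
    exacts [h, G.loopless.irrefl a h]⟩

variable {G H : SimpleGraph V} {s r : Set V} {a b x y : V}

@[simp] lemma addVertex_adj_none_some : (G.addVertex s).Adj none (some b) ↔ b ∈ s := Iff.rfl
@[simp] lemma addVertex_adj_some_none : (G.addVertex s).Adj (some a) none ↔ a ∈ s := Iff.rfl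
@[simp] lemma addVertex_adj_some_some :
    (G.addVertex s).Adj (some a) (some b) ↔ G.Adj a b := Iff.rfl

lemma addVertex_le_addVertex : G.addVertex s ≤ H.addVertex r ↔ G ≤ H ∧ s ⊆ r := by
  constructor
  · intro h
    exact ⟨fun a b hab ↦ h (show (G.addVertex s).Adj (some a) (some b) from hab),
      fun a ha ↦ h (show (G.addVertex s).Adj none (some a) from ha)⟩
  · rintro ⟨h, h'⟩ (_ | a) (_ | b) hab
    exacts [hab, h' hab, h' hab, h hab]

lemma addVertex_injective (s : Set V) :
    Function.Injective fun G : SimpleGraph V ↦ G.addVertex s := fun _ _ h ↦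
  le_antisymm (addVertex_le_addVertex.1 (le_of_eq h)).1 (addVertex_le_addVertex.1 (ge_of_eq h)).1

lemma exists_eq_addVertex (T : SimpleGraph (Option V)) :
    ∃ (G : SimpleGraph V) (s : Set V), T = G.addVertex s := by
  refine ⟨T.comap some, {a | T.Adj none (some a)}, ?_⟩
  ext (_ | a) (_ | b)
  · simp
  · rfl
  · exact T.adj_comm _ _
  · rfl

lemma card_edgeSet_addVertex [Finite V] (G : SimpleGraph V) (s : Set V) :
    Nat.card (G.addVertex s).edgeSet = Nat.card G.edgeSet + s.ncard := by
  have h : (G.addVertex s).edgeSet =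
      Sym2.map some '' G.edgeSet ∪ (fun a ↦ s(none, some a)) '' s := by
    ext e
    induction e with | _ a b
    simp only [mem_edgeSet, Set.mem_union, Set.mem_image, Sym2.exists]
    rcases a with _ | a <;> rcases b with _ | b
    · simp
    · simp
    · simp
    · simp only [addVertex_adj_some_some, Sym2.map_mk, Sym2.eq_iff, Option.some.injEq]
      constructor
      · exact fun h ↦ Or.inl ⟨a, b, h, by simp⟩
      · rintro (⟨c, d, h, ⟨rfl, rfl⟩ | ⟨rfl, rfl⟩⟩ | ⟨c, -, h⟩)
        · exact h
        · exact h.symm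
        · simp at h
  have hd : Disjoint (Sym2.map some '' G.edgeSet) ((fun a ↦ s(none, some a)) '' s) := by
    rw [Set.disjoint_left]
    rintro _ ⟨e, -, rfl⟩ ⟨a, -, h⟩
    induction e with | _ c d
    simp at h
  rw [Nat.card_coe_set_eq, h, Set.ncard_union_eq hd,
    Set.ncard_image_of_injective _ (Sym2.map.injective (Option.some_injective V)),
    Set.ncard_image_of_injective _ (fun a b h ↦ by simpa using h), Nat.card_coe_set_eq]

lemma Reachable.lift {W : Type} {K : SimpleGraph W} (f : V → W)
    (hf : ∀ a b, G.Adj a b → K.Reachable (f a) (f b)) (h : G.Reachable a b) :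
    K.Reachable (f a) (f b) := by
  obtain ⟨p⟩ := h
  induction p with
  | nil => rfl
  | cons h _ ih => exact (hf _ _ h).trans ih

lemma connected_addVertex_singleton : (G.addVertex {x}).Connected ↔ G.Connected := by
  constructor
  · intro h
    have : Nonempty V := ⟨x⟩
    refine ⟨fun a b ↦ (h.preconnected (some a) (some b)).lift (fun o ↦ o.getD x) ?_⟩
    rintro (_ | a) (_ | b) hab
    · exact hab.elim
    · cases hab; rfl
    · cases hab; rfl
    · exact Adj.reachable hab
  · intro h
    have hs (a b : V) : (G.addVertex {x}).Reachable (some a) (some b) :=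
      (h.preconnected a b).lift some fun a b hab ↦ Adj.reachable hab
    have hx : (G.addVertex {x}).Adj none (some x) := rfl
    refine ⟨?_⟩
    rintro (_ | a) (_ | b)
    · rfl
    · exact hx.reachable.trans (hs _ _)
    · exact (hs _ _).trans hx.symm.reachable
    · exact hs _ _

lemma isTree_addVertex_singleton [Finite V] : (G.addVertex {x}).IsTree ↔ G.IsTree := by
  rw [isTree_iff_connected_and_card, isTree_iff_connected_and_card,
    connected_addVertex_singleton, card_edgeSet_addVertex, Set.ncard_singleton, Finite.card_option]
  simp

lemma not_connected_addVertex_empty [Nonempty V] : ¬(G.addVertex ∅).Connected := by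
  intro h
  obtain ⟨v⟩ := ‹Nonempty V›
  obtain ⟨p⟩ := h.preconnected none (some v)
  cases p with
  | @cons _ w _ h _ => rcases w with _ | w <;> exact h

lemma connected_addVertex_pair (hne : x ≠ y) :
    (G.addVertex {x, y}).Connected ↔ (G ⊔ edge x y).Connected := by
  have hxy : (G ⊔ edge x y).Adj x y := by simp [edge_adj, hne]
  constructor
  · intro h
    have : Nonempty V := ⟨x⟩
    refine ⟨fun a b ↦ (h.preconnected (some a) (some b)).lift (fun o ↦ o.getD x) ?_⟩
    rintro (_ | a) (_ | b) hab
    · exact hab.elim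
    · rcases hab with rfl | rfl
      · rfl
      · exact hxy.reachable
    · rcases hab with rfl | rfl
      · rfl
      · exact hxy.symm.reachable
    · exact Adj.reachable (Or.inl hab)
  · intro h
    have hx : (G.addVertex {x, y}).Adj none (some x) := Or.inl rfl
    have hy : (G.addVertex {x, y}).Adj none (some y) := Or.inr rfl
    have hs (a b : V) : (G.addVertex {x, y}).Reachable (some a) (some b) := by
      refine (h.preconnected a b).lift some fun a b hab ↦ ?_
      rw [sup_adj, edge_adj] at hab
      rcases hab with hab | ⟨⟨rfl, rfl⟩ | ⟨rfl, rfl⟩, -⟩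
      · exact Adj.reachable hab
      · exact hx.symm.reachable.trans hy.reachable
      · exact hy.symm.reachable.trans hx.reachable
    refine ⟨?_⟩
    rintro (_ | a) (_ | b)
    · rfl
    · exact hx.reachable.trans (hs _ _)
    · exact (hs _ _).trans hx.symm.reachable
    · exact hs _ _

lemma isTree_addVertex_pair [Finite V] (hne : x ≠ y) :
    (G.addVertex {x, y}).IsTree ↔ ¬G.Adj x y ∧ (G ⊔ edge x y).IsTree := by
  have hedge : (G ⊔ edge x y).edgeSet = insert s(x, y) G.edgeSet := by
    rw [edgeSet_sup, edgeSet_edge_of_ne hne, Set.union_comm, Set.insert_eq]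
  rw [isTree_iff_connected_and_card, isTree_iff_connected_and_card,
    connected_addVertex_pair hne, card_edgeSet_addVertex, Set.ncard_pair hne, Finite.card_option,
    Nat.card_coe_set_eq (G ⊔ edge x y).edgeSet, hedge]
  by_cases h : G.Adj x y
  · have hG : G ⊔ edge x y = G := by simpa [edge_le_iff] using Or.inr h
    rw [hG]
    simp only [h, not_true_eq_false, false_and, iff_false, not_and]
    intro hc
    have := hc.card_vert_le_card_edgeSet_add_one
    omega
  · rw [Set.ncard_insert_of_notMem (by simpa using h), ← Nat.card_coe_set_eq]
    simp only [h, not_false_eq_true, true_and]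
    exact and_congr_right fun _ ↦ by omega

/-- Spanning trees of `H` with a new vertex joined to `x` and `y`, sorted by the neighbours of the
new vertex. -/
lemma ncard_isTree_le_addVertex_pair [Finite V] (hne : x ≠ y) (H : SimpleGraph V)
    (P : SimpleGraph (Option V) → Prop) :
    Set.ncard {T | T ≤ H.addVertex {x, y} ∧ T.IsTree ∧ P T} =
      Set.ncard {T | T ≤ H ∧ T.IsTree ∧ P (T.addVertex {x})} +
      Set.ncard {T | T ≤ H ∧ T.IsTree ∧ P (T.addVertex {y})} +
      Set.ncard {T | T ≤ H ∧ (¬T.Adj x y ∧ (T ⊔ edge x y).IsTree) ∧ P (T.addVertex {x, y})} := by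
  have : Nonempty V := ⟨x⟩
  have hset : {T | T ≤ H.addVertex {x, y} ∧ T.IsTree ∧ P T} =
      (fun T ↦ T.addVertex {x}) '' {T | T ≤ H ∧ T.IsTree ∧ P (T.addVertex {x})} ∪
      (fun T ↦ T.addVertex {y}) '' {T | T ≤ H ∧ T.IsTree ∧ P (T.addVertex {y})} ∪
      (fun T ↦ T.addVertex {x, y}) ''
        {T | T ≤ H ∧ (¬T.Adj x y ∧ (T ⊔ edge x y).IsTree) ∧ P (T.addVertex {x, y})} := by
    ext T
    constructor
    · rintro ⟨hle, hT, hP⟩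
      obtain ⟨K, s, rfl⟩ := exists_eq_addVertex T
      obtain ⟨hK, hs⟩ := addVertex_le_addVertex.1 hle
      rcases Set.subset_pair_iff_eq.1 hs with rfl | rfl | rfl | rfl
      · exact (not_connected_addVertex_empty hT.connected).elim
      · exact Or.inl (Or.inl ⟨K, ⟨hK, isTree_addVertex_singleton.1 hT, hP⟩, rfl⟩)
      · exact Or.inl (Or.inr ⟨K, ⟨hK, isTree_addVertex_singleton.1 hT, hP⟩, rfl⟩)
      · exact Or.inr ⟨K, ⟨hK, (isTree_addVertex_pair hne).1 hT, hP⟩, rfl⟩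
    · rintro ((⟨K, ⟨hK, hT, hP⟩, rfl⟩ | ⟨K, ⟨hK, hT, hP⟩, rfl⟩) | ⟨K, ⟨hK, hT, hP⟩, rfl⟩)
      · exact ⟨addVertex_le_addVertex.2 ⟨hK, by simp⟩, isTree_addVertex_singleton.2 hT, hP⟩
      · exact ⟨addVertex_le_addVertex.2 ⟨hK, by simp⟩, isTree_addVertex_singleton.2 hT, hP⟩
      · exact ⟨addVertex_le_addVertex.2 ⟨hK, le_rfl⟩, (isTree_addVertex_pair hne).2 hT, hP⟩
  have hadj {K L : SimpleGraph V} {s r : Set V} (h : K.addVertex s = L.addVertex r) : s = r :=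
    (addVertex_le_addVertex.1 (le_of_eq h)).2.antisymm (addVertex_le_addVertex.1 (ge_of_eq h)).2
  rw [hset, Set.ncard_union_eq, Set.ncard_union_eq,
    Set.ncard_image_of_injective _ (addVertex_injective _),
    Set.ncard_image_of_injective _ (addVertex_injective _),
    Set.ncard_image_of_injective _ (addVertex_injective _)]
  · rw [Set.disjoint_left]
    rintro _ ⟨K, -, rfl⟩ ⟨L, -, h⟩
    exact hne (by simpa using (hadj h).symm)
  · rw [Set.disjoint_left]
    rintro _ (⟨K, -, rfl⟩ | ⟨K, -, rfl⟩) ⟨L, -, h⟩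
    · have := hadj h ▸ (show y ∈ ({x, y} : Set V) by simp)
      exact hne (by simpa using this.symm)
    · have := hadj h ▸ (show x ∈ ({x, y} : Set V) by simp)
      exact hne (by simpa using this)

/-- Removing the edge `xy` identifies the spanning trees of `G` that contain it with the forests
completed to a tree by it. -/
lemma ncard_sup_edge_isTree [Finite V] (hxy : G.Adj x y)
    (hH : ∀ T : SimpleGraph V, ¬T.Adj x y → (T ≤ H ↔ T ≤ G)) :
    Set.ncard {T | T ≤ H ∧ ¬T.Adj x y ∧ (T ⊔ edge x y).IsTree} =
      Set.ncard {T | T ≤ G ∧ T.IsTree ∧ T.Adj x y} := by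
  have hne := hxy.ne
  have hle {T : SimpleGraph V} (h : T.Adj x y) : edge x y ≤ T := by
    simpa [edge_le_iff] using Or.inr h
  refine Set.ncard_congr (fun T _ ↦ T ⊔ edge x y) ?_ ?_ ?_
  · rintro T ⟨hT, hadj, htree⟩
    exact ⟨sup_le ((hH T hadj).1 hT) (hle hxy), htree, by simp [edge_adj, hne]⟩
  · rintro T U ⟨-, hT, -⟩ ⟨-, hU, -⟩ h
    ext a b
    have h' : (T ⊔ edge x y).Adj a b ↔ (U ⊔ edge x y).Adj a b := by rw [h]
    simp only [sup_adj, edge_adj] at h'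
    by_cases hab : (a = x ∧ b = y) ∨ (a = y ∧ b = x)
    · rcases hab with ⟨rfl, rfl⟩ | ⟨rfl, rfl⟩
      · simp [hT, hU]
      · simp [hT, hU, adj_comm _ a b]
    · grind
  · rintro T ⟨hT, htree, hadj⟩
    have hd : ¬(T \ edge x y).Adj x y := by simp [edge_adj, hne]
    have hs : T \ edge x y ⊔ edge x y = T := by simpa using hle hadj
    exact ⟨T \ edge x y, ⟨(hH _ hd).2 (sdiff_le.trans hT), hd, hs.symm ▸ htree⟩, hs⟩

end SimpleGraph

section Operations

open SimpleGraph

variable {n t u : ℕ}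

lemma EdgeFeasible.subdivide (h : EdgeFeasible n t u) : EdgeFeasible (n + 1) (t + u) u := by
  obtain ⟨m, G, e, hm, he, rfl, rfl⟩ := h
  induction e with | _ x y
  have hxy : G.Adj x y := he
  have hne := hxy.ne
  have hH (T : SimpleGraph (Fin m)) (hT : ¬T.Adj x y) : T ≤ G \ edge x y ↔ T ≤ G := by
    refine ⟨fun h ↦ h.trans sdiff_le, fun h ↦ le_sdiff.2 ⟨h, ?_⟩⟩
    simpa [disjoint_edge] using hT
  have hH' (T : SimpleGraph (Fin m)) : T ≤ G \ edge x y ∧ T.IsTree ↔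
      T ≤ G ∧ T.IsTree ∧ ¬T.Adj x y := by
    by_cases hT : T.Adj x y
    · simp only [hT, not_true_eq_false, and_false, iff_false, not_and]
      intro h
      simpa [edge_adj, hne] using h hT
    · simp [hH T hT, hT]
  have hcard : Fintype.card (Option (Fin m)) ≤ n + 1 := by simpa using hm
  have hadj : ((G \ edge x y).addVertex {x, y}).Adj none (some x) := Or.inl rfl
  have key := edgeFeasible_of_card_le hcard _ hadj
  rw [ncard_isTree_le_addVertex_pair hne _ (fun T ↦ T.Adj none (some x)),
    ncard_isTree_le_addVertex_pair hne _ (fun T ↦ ¬T.Adj none (some x))] at key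
  simp only [addVertex_adj_none_some, Set.mem_singleton_iff, Set.mem_insert_iff, hne, true_or,
    not_true_eq_false, not_false_eq_true, and_true, and_false, Set.ofPred_false, Set.ncard_empty,
    add_zero, zero_add, ncard_sup_edge_isTree hxy hH, hH'] at key
  rw [add_comm (Set.ncard _)]
  exact key

lemma EdgeFeasible.addTriangle (h : EdgeFeasible n t u) :
    EdgeFeasible (n + 1) (2 * t + u) (t + u) ∧ EdgeFeasible (n + 1) (2 * t) (2 * u + t) := by
  obtain ⟨m, G, e, hm, he, rfl, rfl⟩ := h
  induction e with | _ x y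
  have hxy : G.Adj x y := he
  have hne := hxy.ne
  have hcard : Fintype.card (Option (Fin m)) ≤ n + 1 := by simpa using hm
  have hsum : Set.ncard {T | T ≤ G ∧ T.IsTree} =
      Set.ncard {T | T ≤ G ∧ T.IsTree ∧ T.Adj x y} +
      Set.ncard {T | T ≤ G ∧ T.IsTree ∧ ¬T.Adj x y} := by
    rw [← Set.ncard_union_eq]
    · congr 1
      ext T
      simp only [Set.mem_union, Set.mem_ofPred_eq]
      tauto
    · rw [Set.disjoint_left]
      exact fun T h h' ↦ h'.2.2 h.2.2
  have hside : (G.addVertex {x, y}).Adj none (some x) := Or.inl rfl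
  have hbase : (G.addVertex {x, y}).Adj (some x) (some y) := hxy
  have key := edgeFeasible_of_card_le hcard _ hside
  have key' := edgeFeasible_of_card_le hcard _ hbase
  rw [ncard_isTree_le_addVertex_pair hne _ (fun T ↦ T.Adj none (some x)),
    ncard_isTree_le_addVertex_pair hne _ (fun T ↦ ¬T.Adj none (some x))] at key
  rw [ncard_isTree_le_addVertex_pair hne _ (fun T ↦ T.Adj (some x) (some y)),
    ncard_isTree_le_addVertex_pair hne _ (fun T ↦ ¬T.Adj (some x) (some y))] at key'
  have hfalse (T : SimpleGraph (Fin m)) :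
      (¬T.Adj x y ∧ (T ⊔ edge x y).IsTree) ∧ T.Adj x y ↔ False := by tauto
  have htrue (T : SimpleGraph (Fin m)) :
      (¬T.Adj x y ∧ (T ⊔ edge x y).IsTree) ∧ ¬T.Adj x y ↔
        ¬T.Adj x y ∧ (T ⊔ edge x y).IsTree := by tauto
  have hpair := ncard_sup_edge_isTree hxy (H := G) fun _ _ ↦ Iff.rfl
  simp only [addVertex_adj_none_some, Set.mem_singleton_iff, Set.mem_insert_iff, hne, true_or,
    not_true_eq_false, not_false_eq_true, and_true, and_false, Set.ofPred_false, Set.ncard_empty,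
    add_zero, zero_add, hpair, hsum] at key
  simp only [addVertex_adj_some_some, hfalse, htrue, and_false, Set.ofPred_false, Set.ncard_empty,
    add_zero, hpair] at key'
  simp only [mem_edgeSet]
  refine ⟨?_, ?_⟩
  · convert key using 1
    ring
  · convert key' using 1 <;> ring

lemma edgeFeasible_two_one_zero : EdgeFeasible 2 1 0 := by
  have h : (⊤ : SimpleGraph (Fin 2)).Adj 0 1 := by simp
  have key := edgeFeasible_of_card_le (n := 2) (by simp) _ h
  have htop (T : SimpleGraph (Fin 2)) : T ≤ ⊤ ∧ T.IsTree ∧ T.Adj 0 1 ↔ T = ⊤ := by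
    constructor
    · rintro ⟨-, -, h⟩
      ext a b
      fin_cases a <;> fin_cases b <;> simp [h, h.symm]
    · rintro rfl
      refine ⟨le_rfl, ⟨connected_top, ?_⟩, h⟩
      exact .of_card_le_two (by simp)
  have hbot (T : SimpleGraph (Fin 2)) : T ≤ ⊤ ∧ T.IsTree ∧ ¬T.Adj 0 1 ↔ False := by
    refine iff_false_intro ?_
    rintro ⟨-, hT, h⟩
    obtain ⟨b, hb⟩ := hT.connected.preconnected.exists_adj_of_nontrivial (0 : Fin 2)
    fin_cases b
    · exact hb.ne rfl
    · exact h hb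
  simpa only [htop, hbot, Set.ofPred_eq_eq_singleton, Set.ncard_singleton, Set.ofPred_false,
    Set.ncard_empty] using key

end Operations

/-- Pairs obtained from `(1, 0)` by `n` operations, each adding one vertex, restricted so that
no pair arises in two ways. -/
def pellPairs : ℕ → Finset (ℕ × ℕ)
  | 0 => {(1, 0)}
  | n + 1 =>
    ((pellPairs n).filter fun p ↦ p.2 < p.1).image (fun p ↦ (p.1 + p.2, p.2)) ∪
    (pellPairs n).image (fun p ↦ (2 * p.1 + p.2, p.1 + p.2)) ∪
    ((pellPairs n).filter fun p ↦ p.1 ≤ 2 * p.2).image (fun p ↦ (2 * p.1, 2 * p.2 + p.1))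

lemma edgeFeasible_of_mem_pellPairs {n : ℕ} :
    ∀ p ∈ pellPairs n, EdgeFeasible (n + 2) p.1 p.2 := by
  induction n with
  | zero => simpa [pellPairs] using edgeFeasible_two_one_zero
  | succ n ih =>
    intro p hp
    simp only [pellPairs, Finset.mem_union, Finset.mem_image, Finset.mem_filter] at hp
    rcases hp with (⟨q, ⟨hq, -⟩, rfl⟩ | ⟨q, hq, rfl⟩) | ⟨q, ⟨hq, -⟩, rfl⟩
    · exact (ih q hq).subdivide
    · exact (ih q hq).addTriangle.1
    · exact (ih q hq).addTriangle.2

lemma fst_pos_of_mem_pellPairs {n : ℕ} : ∀ p ∈ pellPairs n, 0 < p.1 := by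
  induction n with
  | zero => simp [pellPairs]
  | succ n ih =>
    intro p hp
    simp only [pellPairs, Finset.mem_union, Finset.mem_image, Finset.mem_filter] at hp
    rcases hp with (⟨q, ⟨hq, -⟩, rfl⟩ | ⟨q, hq, rfl⟩) | ⟨q, ⟨hq, -⟩, rfl⟩ <;>
      have := ih q hq <;> dsimp only <;> omega

lemma card_filter_pellPairs_succ (n : ℕ) :
    ((pellPairs (n + 1)).filter fun p ↦ p.2 < p.1 ∧ p.1 ≤ 2 * p.2).card = (pellPairs n).card := by
  rw [← Finset.card_image_of_injective (pellPairs n)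
    (f := fun p ↦ (2 * p.1 + p.2, p.1 + p.2))
    (fun p q h ↦ by simp only [Prod.mk.injEq] at h; ext <;> omega)]
  congr 1
  ext p
  simp only [pellPairs, Finset.mem_union, Finset.mem_image, Finset.mem_filter]
  constructor
  · rintro ⟨(⟨q, ⟨hq, h⟩, rfl⟩ | hp) | ⟨q, ⟨hq, h⟩, rfl⟩, hlt, hle⟩
    · dsimp only at hle; omega
    · exact hp
    · dsimp only at hlt; omega
  · rintro ⟨q, hq, rfl⟩
    have := fst_pos_of_mem_pellPairs q hq
    refine ⟨Or.inl (Or.inr ⟨q, hq, rfl⟩), ?_⟩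
    dsimp only
    omega

lemma card_pellPairs_succ (n : ℕ) :
    (pellPairs (n + 1)).card = 2 * (pellPairs n).card +
      ((pellPairs n).filter fun p ↦ p.2 < p.1 ∧ p.1 ≤ 2 * p.2).card := by
  have hsplit : ((pellPairs n).filter fun p ↦ p.2 < p.1).card +
      ((pellPairs n).filter fun p ↦ p.1 ≤ 2 * p.2).card = (pellPairs n).card +
      ((pellPairs n).filter fun p ↦ p.2 < p.1 ∧ p.1 ≤ 2 * p.2).card := by
    rw [← Finset.card_union_add_card_inter, ← Finset.filter_or, ← Finset.filter_and,
      Finset.filter_true_of_mem (p := fun p : ℕ × ℕ ↦ p.2 < p.1 ∨ p.1 ≤ 2 * p.2)]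
    intro p _
    omega
  rw [pellPairs, Finset.card_union_of_disjoint, Finset.card_union_of_disjoint,
    Finset.card_image_of_injective, Finset.card_image_of_injective, Finset.card_image_of_injective]
  · omega
  · intro p q h
    simp only [Prod.mk.injEq] at h
    ext <;> omega
  · intro p q h
    simp only [Prod.mk.injEq] at h
    ext <;> omega
  · intro p q h
    simp only [Prod.mk.injEq] at h
    ext <;> omega
  · rw [Finset.disjoint_left]
    intro p hp hp'
    simp only [Finset.mem_image, Finset.mem_filter] at hp hp'
    obtain ⟨q, ⟨-, hq⟩, rfl⟩ := hp
    obtain ⟨r, hr, h⟩ := hp'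
    have := fst_pos_of_mem_pellPairs r hr
    simp only [Prod.mk.injEq] at h
    omega
  · rw [Finset.disjoint_left]
    intro p hp hp'
    simp only [Finset.mem_union, Finset.mem_image, Finset.mem_filter] at hp hp'
    obtain ⟨q, ⟨-, hq⟩, rfl⟩ := hp'
    rcases hp with ⟨r, ⟨hr, hlt⟩, h⟩ | ⟨r, hr, h⟩ <;>
      have := fst_pos_of_mem_pellPairs r hr <;> simp only [Prod.mk.injEq] at h <;> omega

lemma card_pellPairs (n : ℕ) :
    2 * √2 * ((pellPairs n).card : ℝ) = (1 + √2) ^ (n + 1) - (1 - √2) ^ (n + 1) ∧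
    2 * √2 * (((pellPairs n).filter fun p ↦ p.2 < p.1 ∧ p.1 ≤ 2 * p.2).card : ℝ) =
      (1 + √2) ^ n - (1 - √2) ^ n := by
  have h2 : √2 ^ 2 = (2 : ℝ) := Real.sq_sqrt (by norm_num)
  induction n with
  | zero =>
    constructor
    · simp [pellPairs]
      ring
    · simp [pellPairs, Finset.filter_singleton]
  | succ n ih =>
    obtain ⟨h, h'⟩ := ih
    refine ⟨?_, by rw [card_filter_pellPairs_succ, h]⟩
    rw [card_pellPairs_succ]
    push_cast
    linear_combination 2 * h + h' - ((1 + √2) ^ n - (1 - √2) ^ n) * h2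

/-- For every positive integer `n`, there are at least `⌊(1+√2)^(n+1)/(2√2)⌋` distinct
`(n+2)`-feasible pairs. -/
theorem many_feasible_pairs_stronger (n : ℕ) (hn : 0 < n) :
    ⌊(1 + Real.sqrt 2) ^ (n + 1) / (2 * Real.sqrt 2)⌋₊ ≤
      Set.ncard {p : ℕ × ℕ | EdgeFeasible (n + 2) p.1 p.2} := by
  have hcard : (pellPairs n).card ≤ Set.ncard {p : ℕ × ℕ | EdgeFeasible (n + 2) p.1 p.2} := by
    rw [← Set.ncard_coe_finset]
    exact Set.ncard_le_ncard (fun p hp ↦ edgeFeasible_of_mem_pellPairs p hp)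
      (finite_setOf_edgeFeasible _)
  refine le_trans (Nat.lt_succ_iff.1 ((Nat.floor_lt' (Nat.succ_ne_zero _)).2 ?_)) hcard
  have h2 : √2 ^ 2 = (2 : ℝ) := Real.sq_sqrt (by norm_num)
  have h1 : 1 ≤ √2 := by rw [Real.one_le_sqrt]; norm_num
  have habs : |1 - √2| ≤ 1 := by rw [abs_le]; constructor <;> nlinarith
  have hpow : (1 - √2) ^ (n + 1) ≤ 1 :=
    (le_abs_self _).trans (by rw [abs_pow]; exact pow_le_one₀ (abs_nonneg _) habs)
  rw [div_lt_iff₀ (by positivity)]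
  push_cast
  linarith [(card_pellPairs n).1]
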